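/- arXiv:1904.13354 — 11 statements merged into one kernel-verified Lean document; each statement's English description precedes it below -/
import Mathlib

section
/- A function F : Set ℕ → Set ℕ is continuous (for the product topology on Set ℕ) if and only if for all U : Set ℕ and all n : ℕ, n ∈ F(U) holds exactly when there exists a finite subset p of U with n ∈ F(p). -/
/-- `Set ℕ` identified with `ℕ → Prop`, with the product topology where `Prop`
carries the Sierpiński topology. -/
instance (priority := high) sierpinskiProductTopology : TopologicalSpace (Set ℕ) :=
  inferInstanceAs (TopologicalSpace (ℕ → Prop))

/-- Open sets of the Sierpiński space are closed under implication. -/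
theorem mem_of_isOpen_of_imp {u : Set Prop} (hu : IsOpen u) {a b : Prop} (ha : a ∈ u)
    (hab : a → b) : b ∈ u := by
  by_cases h : a
  · rwa [eq_true (hab h), ← eq_true h]
  · have hmem := hu.mem_nhds ha
    rw [eq_false h, nhds_false, Filter.mem_top] at hmem
    exact hmem ▸ Set.mem_univ b

theorem isOpen_setOf_superset {p : Set ℕ} (hp : p.Finite) : IsOpen {V : Set ℕ | p ⊆ V} := by
  have h : {V : Set ℕ | p ⊆ V} = ⋂ a ∈ p, {V : Set ℕ | a ∈ V} := by
    ext V
    simp [Set.subset_def]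
  rw [h]
  exact hp.isOpen_biInter fun a _ =>
    continuous_Prop.1 (continuous_apply (A := fun _ : ℕ => Prop) a)

theorem isOpen_iff_finite_superset {S : Set (Set ℕ)} :
    IsOpen S ↔ ∀ U ∈ S, ∃ p : Set ℕ, p.Finite ∧ p ⊆ U ∧ ∀ V : Set ℕ, p ⊆ V → V ∈ S := by
  constructor
  · intro hS U hU
    obtain ⟨I, u, hu, hsub⟩ := (isOpen_pi_iff (A := fun _ : ℕ => Prop)).1 hS U hU
    refine ⟨I ∩ U, I.finite_toSet.inter_of_left U, Set.inter_subset_right, fun V hV => ?_⟩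
    exact hsub fun a ha => mem_of_isOpen_of_imp (hu a ha).1 (hu a ha).2 fun h => hV ⟨ha, h⟩
  · intro h
    refine isOpen_iff_forall_mem_open.2 fun U hU => ?_
    obtain ⟨p, hp, hpU, hpS⟩ := h U hU
    exact ⟨{V | p ⊆ V}, hpS, isOpen_setOf_superset hp, hpU⟩

theorem continuous_iff_isOpen_setOf_mem {F : Set ℕ → Set ℕ} :
    Continuous F ↔ ∀ n, IsOpen {U | n ∈ F U} :=
  (continuous_pi_iff (A := fun _ : ℕ => Prop)).trans (forall_congr' fun _ => continuous_Prop)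

theorem continuous_iff_finite_approx (F : Set ℕ → Set ℕ) :
    Continuous F ↔
      ∀ (U : Set ℕ) (n : ℕ), n ∈ F U ↔ ∃ p : Set ℕ, p.Finite ∧ p ⊆ U ∧ n ∈ F p := by
  simp only [continuous_iff_isOpen_setOf_mem, isOpen_iff_finite_superset, Set.mem_ofPred_eq]
  constructor
  · refine fun h U n => ⟨fun hn => ?_, fun ⟨p, _, hpU, hn⟩ => ?_⟩
    · obtain ⟨p, hp, hpU, hF⟩ := h n U hn
      exact ⟨p, hp, hpU, hF p subset_rfl⟩
    · obtain ⟨q, _, hqp, hF⟩ := h n p hn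
      exact hF U (hqp.trans hpU)
  · intro h n U hn
    obtain ⟨p, hp, hpU, hnp⟩ := (h U n).1 hn
    exact ⟨p, hp, hpU, fun V hV => (h V n).2 ⟨p, hp, hV, hnp⟩⟩
end

section
/- For every continuous function F : Set ℕ → Set ℕ and every V : Set ℕ, one has graph(F) · V = F(V). -/
/-- `eSet n` is the unique finite set of naturals with `n = ∑_{k ∈ eSet n} 2^k`. -/
def eSet (n : ℕ) : Set ℕ := {k | n.testBit k}

/-- The application operation of Scott's graph model. -/
def ap (U V : Set ℕ) : Set ℕ := {n | ∃ m, eSet m ⊆ V ∧ Nat.pair m n ∈ U}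

/-- The graph of a function `F : Set ℕ → Set ℕ`. -/
def sGraph (F : Set ℕ → Set ℕ) : Set ℕ :=
  {x | ∃ m n : ℕ, x = Nat.pair m n ∧ n ∈ F (eSet m)}

theorem IsOpen.mem_of_imp {u : Set Prop} (hu : IsOpen u) {p q : Prop} (hp : p ∈ u)
    (hpq : p → q) : q ∈ u := by
  by_cases h : p
  · rwa [show q = p from propext ⟨fun _ => h, hpq⟩]
  · have hmem : u ∈ nhds p := hu.mem_nhds hp
    rw [eq_false h, nhds_false, Filter.mem_top] at hmem
    exact hmem ▸ Set.mem_univ q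

/-- Open sets of `Set ℕ` are Scott open: membership is witnessed by a finite subset. -/
theorem exists_finset_subset_of_isOpen {U : Set (Set ℕ)} (hU : IsOpen U) {V : Set ℕ}
    (hV : V ∈ U) : ∃ s : Finset ℕ, (s : Set ℕ) ⊆ V ∧ ∀ W : Set ℕ, (s : Set ℕ) ⊆ W → W ∈ U := by
  classical
  obtain ⟨I, u, hu, hIU⟩ := (isOpen_pi_iff (A := fun _ : ℕ => Prop)).1 hU V hV
  refine ⟨I.filter (· ∈ V), fun k hk => (Finset.mem_filter.1 hk).2, fun W hW => hIU ?_⟩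
  intro k hk
  exact (hu k hk).1.mem_of_imp (hu k hk).2 fun hkV => hW (Finset.mem_filter.2 ⟨hk, hkV⟩)

theorem exists_eSet_eq (s : Finset ℕ) : ∃ m, eSet m = s := by
  induction s using Finset.induction_on with
  | empty => exact ⟨0, by simp [eSet]⟩
  | insert a s _ ih =>
    obtain ⟨m, hm⟩ := ih
    refine ⟨2 ^ a ||| m, ?_⟩
    rw [Finset.coe_insert, ← hm]
    ext k
    simp [eSet, Nat.testBit_two_pow, eq_comm (a := k)]

theorem isOpen_setOf_mem_apply {F : Set ℕ → Set ℕ} (hF : Continuous F) (n : ℕ) :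
    IsOpen {V | n ∈ F V} :=
  continuous_Prop.1 ((continuous_apply (A := fun _ : ℕ => Prop) n).comp hF)

theorem mem_ap_sGraph {F : Set ℕ → Set ℕ} {V : Set ℕ} {n : ℕ} :
    n ∈ ap (sGraph F) V ↔ ∃ m, eSet m ⊆ V ∧ n ∈ F (eSet m) := by
  simp [ap, sGraph, Nat.pair_eq_pair]

theorem graph_ap (F : Set ℕ → Set ℕ) (hF : Continuous F) :
    ∀ V : Set ℕ, ap (sGraph F) V = F V := by
  intro V
  ext n
  rw [mem_ap_sGraph]
  constructor
  · rintro ⟨m, hmV, hn⟩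
    obtain ⟨s, hs, hsF⟩ := exists_finset_subset_of_isOpen (isOpen_setOf_mem_apply hF n) hn
    exact hsF V (hs.trans hmV)
  · intro hn
    obtain ⟨s, hs, hsF⟩ := exists_finset_subset_of_isOpen (isOpen_setOf_mem_apply hF n) hn
    obtain ⟨m, hm⟩ := exists_eSet_eq s
    exact ⟨m, hm ▸ hs, hsF _ hm.ge⟩
end

section
/- The application operation (U, V) ↦ U · V is continuous as a map from Set ℕ × Set ℕ (with the product topology) to Set ℕ. -/
theorem isOpen_setOf_mem (k : ℕ) : IsOpen {V : Set ℕ | k ∈ V} :=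
  continuous_Prop.mp (continuous_apply (A := fun _ : ℕ => Prop) k)

theorem finite_eSet (m : ℕ) : (eSet m).Finite :=
  (Set.finite_lt_nat m).subset fun _ hk =>
    Nat.lt_two_pow_self.trans_le (Nat.ge_two_pow_of_testBit hk)

theorem isOpen_setOf_eSet_subset (m : ℕ) : IsOpen {V : Set ℕ | eSet m ⊆ V} := by
  have h : {V : Set ℕ | eSet m ⊆ V} = ⋂ k ∈ eSet m, {V : Set ℕ | k ∈ V} := by
    ext V
    simp [Set.subset_def]
  rw [h]
  exact (finite_eSet m).isOpen_biInter fun k _ => isOpen_setOf_mem k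

theorem continuous_ap : Continuous (fun UV : Set ℕ × Set ℕ => ap UV.1 UV.2) := by
  refine continuous_pi (A := fun _ : ℕ => Prop) fun n => continuous_Prop.mpr ?_
  have h : {UV : Set ℕ × Set ℕ | n ∈ ap UV.1 UV.2} =
      ⋃ m, {U : Set ℕ | Nat.pair m n ∈ U} ×ˢ {V : Set ℕ | eSet m ⊆ V} := by
    ext UV
    simp [ap, and_comm]
  exact h ▸ isOpen_iUnion fun m =>
    (isOpen_setOf_mem (Nat.pair m n)).prod (isOpen_setOf_eSet_subset m)
end

section
/- There exist elements p, p₀, p₁ : Set ℕ such that for all U, V : Set ℕ one has p · U · V = {2n | n ∈ U} ∪ {2n+1 | n ∈ V}, p₀ · (p · U · V) = U, and p₁ · (p · U · V) = V. -/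
theorem eSet_zero : eSet 0 = ∅ := by
  simp [eSet]

theorem eSet_two_pow (k : ℕ) : eSet (2 ^ k) = {k} := by
  ext j
  simp [eSet, Nat.testBit_two_pow, eq_comm]

/-- The graph of a function on sets of naturals, given by its values on the sets `eSet m`. -/
def graph (F : ℕ → Set ℕ) : Set ℕ := {x | x.unpair.2 ∈ F x.unpair.1}

theorem mem_ap_graph {F : ℕ → Set ℕ} {V : Set ℕ} {n : ℕ} :
    n ∈ ap (graph F) V ↔ ∃ m, eSet m ⊆ V ∧ n ∈ F m := by
  simp [ap, graph]

theorem ap_graph_preimage (f : ℕ → ℕ) (V : Set ℕ) :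
    ap (graph fun m => f ⁻¹' eSet m) V = f ⁻¹' V := by
  ext n
  rw [mem_ap_graph]
  constructor
  · rintro ⟨m, hm, hn⟩
    exact hm hn
  · intro hn
    exact ⟨2 ^ f n, by simpa [eSet_two_pow] using hn, by simp [eSet_two_pow]⟩

theorem ap_ap_graph_image_union (f g : ℕ → ℕ) (U V : Set ℕ) :
    ap (ap (graph fun a => graph fun b => f '' eSet a ∪ g '' eSet b) U) V =
      f '' U ∪ g '' V := by
  ext n
  have key : n ∈ ap (ap (graph fun a => graph fun b => f '' eSet a ∪ g '' eSet b) U) V ↔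
      ∃ b, eSet b ⊆ V ∧ ∃ a, eSet a ⊆ U ∧ n ∈ f '' eSet a ∪ g '' eSet b := by
    simp [ap, graph]
  rw [key]
  constructor
  · rintro ⟨b, hb, a, ha, hn⟩
    exact Set.union_subset_union (Set.image_mono ha) (Set.image_mono hb) hn
  · rintro (⟨k, hk, rfl⟩ | ⟨k, hk, rfl⟩)
    · exact ⟨0, by simp [eSet_zero], 2 ^ k, by simpa [eSet_two_pow] using hk,
        by simp [eSet_two_pow]⟩
    · exact ⟨2 ^ k, by simpa [eSet_two_pow] using hk, 0, by simp [eSet_zero],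
        by simp [eSet_two_pow]⟩

theorem exists_pairing_combinators :
    ∃ P P₀ P₁ : Set ℕ, ∀ U V : Set ℕ,
      ap (ap P U) V = (fun n => 2 * n) '' U ∪ (fun n => 2 * n + 1) '' V ∧
      ap P₀ (ap (ap P U) V) = U ∧
      ap P₁ (ap (ap P U) V) = V := by
  refine ⟨graph fun a => graph fun b =>
      (fun n => 2 * n) '' eSet a ∪ (fun n => 2 * n + 1) '' eSet b,
    graph fun m => (fun n => 2 * n) ⁻¹' eSet m,
    graph fun m => (fun n => 2 * n + 1) ⁻¹' eSet m, fun U V => ?_⟩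
  rw [ap_ap_graph_image_union, ap_graph_preimage, ap_graph_preimage]
  refine ⟨rfl, ?_, ?_⟩
  · ext n
    have odd_ne (k : ℕ) : 2 * k + 1 ≠ 2 * n := by lia
    simp [odd_ne]
  · ext n
    have even_ne (k : ℕ) : 2 * k ≠ 2 * n + 1 := by lia
    simp [even_ne]
end

section
/- There exist elements K, S : Set ℕ such that for all U, V, W : Set ℕ one has K · U · V = U and S · U · V · W = (U · W) · (V · W); that is, Set ℕ with the graph-model application is a (total) combinatory algebra. -/
theorem eSet_or (a b : ℕ) : eSet (a ||| b) = eSet a ∪ eSet b := by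
  ext k
  simp [eSet, Nat.testBit_or]

theorem eSet_finite (n : ℕ) : (eSet n).Finite := by
  refine (Set.finite_lt_nat n).subset fun k hk => ?_
  exact Nat.lt_two_pow_self.trans_le (Nat.ge_two_pow_of_testBit hk)

/-- Continuity for the Scott topology: membership in `F V` is monotone in `V` and witnessed by
a finite subset of `V`. -/
def IsGraphContinuous (F : Set ℕ → Set ℕ) : Prop :=
  Monotone F ∧ ∀ V, ∀ n ∈ F V, ∃ m, eSet m ⊆ V ∧ n ∈ F (eSet m)

/-- The set coding a function on `Set ℕ` by its values on finite sets. -/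
def graphCode (F : Set ℕ → Set ℕ) : Set ℕ := {k | k.unpair.2 ∈ F (eSet k.unpair.1)}

theorem pair_mem_graphCode (F : Set ℕ → Set ℕ) (m n : ℕ) :
    Nat.pair m n ∈ graphCode F ↔ n ∈ F (eSet m) := by
  simp [graphCode]

theorem ap_mono {U U' V V' : Set ℕ} (hU : U ⊆ U') (hV : V ⊆ V') : ap U V ⊆ ap U' V' :=
  fun _ ⟨m, hm, hmn⟩ => ⟨m, hm.trans hV, hU hmn⟩

namespace IsGraphContinuous

variable {F G : Set ℕ → Set ℕ}

theorem ap_graphCode (hF : IsGraphContinuous F) (V : Set ℕ) : ap (graphCode F) V = F V := by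
  ext n
  simp only [ap, Set.mem_ofPred_eq, pair_mem_graphCode]
  exact ⟨fun ⟨_, hm, hn⟩ => hF.1 hm hn, hF.2 V n⟩

theorem const (U : Set ℕ) : IsGraphContinuous fun _ => U :=
  ⟨monotone_const, fun _ _ hn => ⟨0, by simp [eSet], hn⟩⟩

theorem id : IsGraphContinuous fun V => V :=
  ⟨monotone_id, fun V n hn => ⟨2 ^ n, by simpa [eSet_two_pow] using hn, by simp [eSet_two_pow]⟩⟩

theorem exists_eSet_of_finite (hG : IsGraphContinuous G) {V A : Set ℕ} (hA : A.Finite)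
    (hAV : A ⊆ G V) : ∃ m, eSet m ⊆ V ∧ A ⊆ G (eSet m) := by
  induction A, hA using Set.Finite.induction_on with
  | empty => exact ⟨0, by simp [eSet], Set.empty_subset _⟩
  | @insert a A _ _ ih =>
    obtain ⟨haV, hAV⟩ := Set.insert_subset_iff.1 hAV
    obtain ⟨p, hp, hpa⟩ := hG.2 V a haV
    obtain ⟨q, hq, hqA⟩ := ih hAV
    refine ⟨p ||| q, ?_, ?_⟩ <;> rw [eSet_or]
    · exact Set.union_subset hp hq
    · exact Set.insert_subset (hG.1 Set.subset_union_left hpa)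
        (hqA.trans (hG.1 Set.subset_union_right))

theorem ap (hF : IsGraphContinuous F) (hG : IsGraphContinuous G) :
    IsGraphContinuous fun V => ap (F V) (G V) := by
  refine ⟨fun _ _ h => ap_mono (hF.1 h) (hG.1 h), ?_⟩
  rintro V n ⟨m, hm, hmn⟩
  obtain ⟨p, hp, hpF⟩ := hF.2 V _ hmn
  obtain ⟨q, hq, hqG⟩ := hG.exists_eSet_of_finite (eSet_finite m) hm
  refine ⟨p ||| q, ?_, m, ?_, ?_⟩ <;> rw [eSet_or]
  · exact Set.union_subset hp hq
  · exact hqG.trans (hG.1 Set.subset_union_right)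
  · exact hF.1 Set.subset_union_left hpF

theorem graphCode {H : Set ℕ → Set ℕ → Set ℕ} (hH : ∀ W, IsGraphContinuous fun V => H V W) :
    IsGraphContinuous fun V => graphCode (H V) :=
  ⟨fun _ _ h _ hk => (hH _).1 h hk, fun V _ hk => (hH _).2 V _ hk⟩

end IsGraphContinuous

theorem exists_K_S :
    ∃ K S : Set ℕ, ∀ U V W : Set ℕ,
      ap (ap K U) V = U ∧
      ap (ap (ap S U) V) W = ap (ap U W) (ap V W) := by
  have hW (U V : Set ℕ) : IsGraphContinuous fun W => ap (ap U W) (ap V W) :=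
    ((IsGraphContinuous.const U).ap .id).ap ((IsGraphContinuous.const V).ap .id)
  have hV (U : Set ℕ) : IsGraphContinuous fun V => graphCode fun W => ap (ap U W) (ap V W) :=
    .graphCode fun W => (IsGraphContinuous.const _).ap (IsGraphContinuous.id.ap (.const W))
  have hU : IsGraphContinuous fun U =>
      graphCode fun V => graphCode fun W => ap (ap U W) (ap V W) :=
    .graphCode fun V => .graphCode fun W =>
      (IsGraphContinuous.id.ap (.const W)).ap (.const _)
  refine ⟨graphCode fun U => graphCode fun _ => U,
    graphCode fun U => graphCode fun V => graphCode fun W => ap (ap U W) (ap V W),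
    fun U V W => ⟨?_, ?_⟩⟩
  · rw [(IsGraphContinuous.graphCode fun _ => .id).ap_graphCode,
      (IsGraphContinuous.const U).ap_graphCode]
  · rw [hU.ap_graphCode, (hV U).ap_graphCode, (hW U V).ap_graphCode]
end

section
/- There exists an element W : Set ℕ such that for all U : Set ℕ and all n : ℕ, W · U · {n} equals {1} if n ∈ U, and equals ∅ if n ∉ U. (This element tracks the map sending a set of natural numbers to its characteristic function, viewed as a morphism from the object of realizers to the exponential Σ^N.) -/
theorem eSet_two_pow_subset_iff (n : ℕ) (V : Set ℕ) : eSet (2 ^ n) ⊆ V ↔ n ∈ V := by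
  simp [eSet, Nat.testBit_two_pow, Set.subset_def]

/-- The graph of the map sending a set to (the graph of) its characteristic function. -/
def characteristicTracker : Set ℕ :=
  Set.range fun k : ℕ => Nat.pair (2 ^ k) (Nat.pair (2 ^ k) 1)

theorem mem_ap_characteristicTracker (U : Set ℕ) (x : ℕ) :
    x ∈ ap characteristicTracker U ↔ ∃ k ∈ U, Nat.pair (2 ^ k) 1 = x := by
  constructor
  · rintro ⟨m, hm, k, hk⟩
    obtain ⟨rfl, rfl⟩ := Nat.pair_eq_pair.mp hk
    exact ⟨k, (eSet_two_pow_subset_iff k U).mp hm, rfl⟩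
  · rintro ⟨k, hk, rfl⟩
    exact ⟨2 ^ k, (eSet_two_pow_subset_iff k U).mpr hk, k, rfl⟩

theorem mem_ap_ap_characteristicTracker (U V : Set ℕ) (x : ℕ) :
    x ∈ ap (ap characteristicTracker U) V ↔ (U ∩ V).Nonempty ∧ x = 1 := by
  constructor
  · rintro ⟨m, hm, h⟩
    obtain ⟨k, hk, h⟩ := (mem_ap_characteristicTracker U _).mp h
    obtain ⟨rfl, rfl⟩ := Nat.pair_eq_pair.mp h
    exact ⟨⟨k, hk, (eSet_two_pow_subset_iff k V).mp hm⟩, rfl⟩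
  · rintro ⟨⟨k, hU, hV⟩, rfl⟩
    exact ⟨2 ^ k, (eSet_two_pow_subset_iff k V).mpr hV,
      (mem_ap_characteristicTracker U _).mpr ⟨k, hU, rfl⟩⟩

theorem exists_characteristic_function_tracker :
    ∃ W : Set ℕ, ∀ (U : Set ℕ) (n : ℕ),
      (n ∈ U → ap (ap W U) {n} = {1}) ∧
      (n ∉ U → ap (ap W U) {n} = ∅) := by
  refine ⟨characteristicTracker, fun U n => ⟨fun hn => ?_, fun hn => ?_⟩⟩ <;> ext x <;>
    simp [mem_ap_ap_characteristicTracker, hn]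
end

section
/- There exists an element G : Set ℕ such that for every function f : ℕ → Bool and every U : Set ℕ tracking f (meaning U · {n} = {1} whenever f(n) = true and U · {n} = ∅ whenever f(n) = false), one has G · U = {n : ℕ | f(n) = true}. (This element tracks the inverse of the characteristic-function map, giving the isomorphism between the object of realizers and Σ^N.) -/
/-- The set of all `⟨m, n⟩` with `1 ∈ e_m · {n}`. -/
def supportTracker : Set ℕ :=
  {p | 1 ∈ ap (eSet p.unpair.1) {p.unpair.2}}

theorem mem_ap_supportTracker {U : Set ℕ} {n : ℕ} :
    n ∈ ap supportTracker U ↔ 1 ∈ ap U {n} := by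
  constructor
  · rintro ⟨m, hm, h⟩
    simp only [supportTracker, Set.mem_ofPred_eq, Nat.unpair_pair] at h
    obtain ⟨k, hk, hkm⟩ := h
    exact ⟨k, hk, hm hkm⟩
  · rintro ⟨k, hk, hkU⟩
    refine ⟨2 ^ Nat.pair k 1, by simpa [eSet_two_pow] using hkU, ?_⟩
    simp only [supportTracker, Set.mem_ofPred_eq, Nat.unpair_pair]
    exact ⟨k, hk, by simp [eSet_two_pow]⟩

theorem exists_characteristic_function_inverse_tracker :
    ∃ G : Set ℕ, ∀ (f : ℕ → Bool) (U : Set ℕ),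
      (∀ n : ℕ, (f n = true → ap U {n} = {1}) ∧ (f n = false → ap U {n} = ∅)) →
      ap G U = {n : ℕ | f n = true} := by
  refine ⟨supportTracker, fun f U hU => ?_⟩
  ext n
  rw [mem_ap_supportTracker, Set.mem_ofPred_eq]
  cases hf : f n
  · simp [(hU n).2 hf]
  · simp [(hU n).1 hf]
end

section
/- Let X be a type, let E : X → Set (Set ℕ) be such that E(x) is nonempty for every x, and let f : X → Bool. Then there exists U : Set ℕ such that for all x and all V ∈ E(x), U · V = {1} if f(x) = true and U · V = ∅ if f(x) = false, if and only if there exists an open set 𝒰 ⊆ Set ℕ (for the product topology) such that E(x) ⊆ 𝒰 whenever f(x) = true and E(x) ∩ 𝒰 = ∅ whenever f(x) = false. (This is the characterization of Σ-subobjects of an assembly: morphisms from the assembly (X, E) to the Sierpiński object correspond to suitable open subsets of Set ℕ.) -/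
theorem exists_eSet_eq_coe (F : Finset ℕ) : ∃ m, eSet m = F := by
  refine ⟨∑ i ∈ F, 2 ^ i, ?_⟩
  ext k
  change (∑ i ∈ F, 2 ^ i).testBit k ↔ k ∈ F
  rw [← Nat.mem_bitIndices, ← List.mem_toFinset, Finset.toFinset_bitIndices_sum_two_pow]

theorem isOpen_setOf_subset {F : Set ℕ} (hF : F.Finite) : IsOpen {V : Set ℕ | F ⊆ V} := by
  have h : {V : Set ℕ | F ⊆ V} = ⋂ k ∈ F, {V : Set ℕ | k ∈ V} := by
    ext V
    simp [Set.subset_def]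
  rw [h]
  exact hF.isOpen_biInter fun k _ =>
    continuous_Prop.1 (continuous_apply (A := fun _ : ℕ => Prop) k)

theorem isOpen_setOf_mem_ap (U : Set ℕ) (n : ℕ) : IsOpen {V : Set ℕ | n ∈ ap U V} := by
  have h : {V : Set ℕ | n ∈ ap U V} =
      ⋃ m ∈ {m | Nat.pair m n ∈ U}, {V : Set ℕ | eSet m ⊆ V} := by
    ext V
    simp [ap, and_comm]
  rw [h]
  exact isOpen_biUnion fun m _ => isOpen_setOf_subset (finite_eSet m)

theorem eq_univ_of_isOpen_of_false_mem {u : Set Prop} (hu : IsOpen u) (h : False ∈ u) :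
    u = Set.univ := by
  simpa [nhds_false] using hu.mem_nhds h

/-- The sets `{W | eSet m ⊆ W}` form a basis of the product topology. -/
theorem exists_eSet_subset_of_isOpen {𝒰 : Set (Set ℕ)} (h𝒰 : IsOpen 𝒰) {V : Set ℕ}
    (hV : V ∈ 𝒰) : ∃ m, eSet m ⊆ V ∧ ∀ W, eSet m ⊆ W → W ∈ 𝒰 := by
  classical
  obtain ⟨I, u, hu, hsub⟩ := (isOpen_pi_iff (A := fun _ : ℕ => Prop)).1 h𝒰 V hV
  obtain ⟨m, hm⟩ := exists_eSet_eq_coe (I.filter (· ∈ V))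
  refine ⟨m, fun k hk => ?_, fun W hW => hsub fun i hi => ?_⟩
  · rw [hm] at hk
    exact (Finset.mem_filter.1 hk).2
  · obtain ⟨hopen, hmem⟩ := hu i hi
    by_cases hiV : i ∈ V
    · have hiW : i ∈ W := hW (hm ▸ Finset.mem_filter.2 ⟨hi, hiV⟩)
      have hVW : V i = W i := propext ⟨fun _ => hiW, fun _ => hiV⟩
      exact hVW ▸ hmem
    · have hfalse : V i = False := propext ⟨hiV, False.elim⟩
      rw [eq_univ_of_isOpen_of_false_mem hopen (hfalse ▸ hmem)]
      trivial

theorem exists_ap_eq_of_isOpen {𝒰 : Set (Set ℕ)} (h𝒰 : IsOpen 𝒰) (n : ℕ) :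
    ∃ U : Set ℕ, ∀ V, (V ∈ 𝒰 → ap U V = {n}) ∧ (V ∉ 𝒰 → ap U V = ∅) := by
  refine ⟨{p | p.unpair.2 = n ∧ ∀ W, eSet p.unpair.1 ⊆ W → W ∈ 𝒰}, fun V => ⟨fun hV => ?_,
    fun hV => ?_⟩⟩
  · obtain ⟨m, hmV, hm⟩ := exists_eSet_subset_of_isOpen h𝒰 hV
    ext k
    constructor
    · rintro ⟨l, -, hl, -⟩
      simpa using hl
    · rintro rfl
      exact ⟨m, hmV, by simpa using hm⟩
  · refine Set.eq_empty_of_forall_notMem ?_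
    rintro k ⟨l, hlV, -, hl⟩
    exact hV (hl V (by simpa using hlV))

theorem sigma_subobject_characterization {X : Type*} (E : X → Set (Set ℕ))
    (hE : ∀ x, (E x).Nonempty) (f : X → Bool) :
    (∃ U : Set ℕ, ∀ x : X, ∀ V ∈ E x,
        (f x = true → ap U V = {1}) ∧ (f x = false → ap U V = ∅)) ↔
    (∃ 𝒰 : Set (Set ℕ), IsOpen 𝒰 ∧ ∀ x : X,
        (f x = true → E x ⊆ 𝒰) ∧ (f x = false → E x ∩ 𝒰 = ∅)) := by
  constructor
  · rintro ⟨U, hU⟩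
    refine ⟨{V | 1 ∈ ap U V}, isOpen_setOf_mem_ap U 1, fun x => ⟨fun hx V hV => ?_, fun hx => ?_⟩⟩
    · simp [(hU x V hV).1 hx]
    · refine Set.eq_empty_of_forall_notMem ?_
      rintro V ⟨hV, hmem⟩
      simp [(hU x V hV).2 hx] at hmem
  · rintro ⟨𝒰, h𝒰, h⟩
    obtain ⟨U, hU⟩ := exists_ap_eq_of_isOpen h𝒰 1
    refine ⟨U, fun x V hV => ⟨fun hx => (hU V).1 ((h x).1 hx hV), fun hx => (hU V).2 fun hmem => ?_⟩⟩
    exact Set.eq_empty_iff_forall_notMem.1 ((h x).2 hx) V ⟨hV, hmem⟩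
end

section
/- There do not exist continuous functions F : Set ℕ × Set ℕ → Set ℕ and G : Set ℕ → Set ℕ such that for all U, V : Set ℕ: (i) if 1 ∈ U or 1 ∈ V then 1 ∈ F(U, V), and (ii) if 1 ∈ F(U, V) then either G(F(U, V)) = {0} and 1 ∈ U, or G(F(U, V)) = {1} and 1 ∈ V. (This expresses that the Sierpiński object, as a dominance in the Scott realizability topos, is not closed under finite unions.) -/
theorem specializes_of_subset {U V : Set ℕ} (h : U ⊆ V) : V ⤳ U := by
  refine (specializes_pi (A := fun _ : ℕ => Prop) (f := V) (g := U)).2 fun n => ?_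
  by_cases hn : U n
  · have hV : V n := h hn
    rw [eq_true hV, eq_true hn]
  · rw [eq_false hn, Specializes, nhds_false]
    exact le_top

theorem isOpen_setOf_mem_s14 (n : ℕ) : IsOpen {U : Set ℕ | n ∈ U} :=
  isOpen_iff_continuous_mem.2 (continuous_apply (A := fun _ : ℕ => Prop) n)

theorem subset_of_specializes {U V : Set ℕ} (h : V ⤳ U) : U ⊆ V :=
  fun n hn => h.mem_open (isOpen_setOf_mem_s14 n) hn

theorem sierpinski_not_closed_under_unions :
    ¬ ∃ (F : Set ℕ × Set ℕ → Set ℕ) (G : Set ℕ → Set ℕ),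
        Continuous F ∧ Continuous G ∧
        ∀ U V : Set ℕ,
          ((1 ∈ U ∨ 1 ∈ V) → 1 ∈ F (U, V)) ∧
          (1 ∈ F (U, V) →
            (G (F (U, V)) = {0} ∧ 1 ∈ U) ∨ (G (F (U, V)) = {1} ∧ 1 ∈ V)) := by
  rintro ⟨F, G, hF, hG, h⟩
  have mono {U V U' V' : Set ℕ} (hU : U ⊆ U') (hV : V ⊆ V') :
      G (F (U, V)) ⊆ G (F (U', V')) :=
    subset_of_specializes
      (((specializes_of_subset hU).prod (specializes_of_subset hV)).map (hG.comp hF))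
  have left : G (F ({1}, ∅)) = {0} := by
    simpa using (h {1} ∅).2 ((h {1} ∅).1 (by simp))
  have right : G (F (∅, {1})) = {1} := by
    simpa using (h ∅ {1}).2 ((h ∅ {1}).1 (by simp))
  have mem_zero : 0 ∈ G (F ({1}, {1})) :=
    mono subset_rfl (Set.empty_subset _) (by simp [left])
  have mem_one : 1 ∈ G (F ({1}, {1})) :=
    mono (Set.empty_subset _) subset_rfl (by simp [right])
  rcases (h {1} {1}).2 ((h {1} {1}).1 (by simp)) with ⟨e, -⟩ | ⟨e, -⟩
  · simp [e] at mem_one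
  · simp [e] at mem_zero
end

section
/- Let X be a topological space whose topology is generated (as the topology generated from a subbasis) by the range of a function S : ℕ → Set X, and suppose X is T₀. Then the map e : X → Set ℕ defined by e(x) = {n | x ∈ S(n)} is a topological embedding of X into Set ℕ (with the product topology). -/
theorem embedding_of_countably_based_T0 {X : Type*} [t : TopologicalSpace X] [T0Space X]
    (S : ℕ → Set X) (hS : t = TopologicalSpace.generateFrom (Set.range S)) :
    Topology.IsEmbedding (fun x : X => ({n : ℕ | x ∈ S n} : Set ℕ)) := by
  have isOpen_S (n : ℕ) : IsOpen (S n) := by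
    rw [hS]
    exact TopologicalSpace.isOpen_generateFrom_of_mem ⟨n, rfl⟩
  have continuous_e : Continuous (fun x : X => ({n : ℕ | x ∈ S n} : Set ℕ)) :=
    continuous_pi (A := fun _ : ℕ => Prop) fun n => continuous_Prop.2 (isOpen_S n)
  refine Topology.IsInducing.isEmbedding ⟨le_antisymm continuous_e.le_induced ?_⟩
  conv_rhs => rw [hS]
  refine le_generateFrom ?_
  rintro _ ⟨n, rfl⟩
  exact ⟨{s : Set ℕ | n ∈ s},
    continuous_Prop.1 (continuous_apply (A := fun _ : ℕ => Prop) n), rfl⟩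
end

section
/- Let X and Y be topological spaces whose topologies are generated by the ranges of S : ℕ → Set X and T : ℕ → Set Y respectively, and let e_X(x) = {n | x ∈ S(n)} and e_Y(y) = {n | y ∈ T(n)}. Then for every continuous map f : X → Y there exists a continuous map F : Set ℕ → Set ℕ (with respect to the product topology on Set ℕ) such that F(e_X(x)) = e_Y(f(x)) for all x ∈ X. -/
theorem isOpen_setOf_nat_mem (n : ℕ) : IsOpen {A : Set ℕ | n ∈ A} :=
  continuous_Prop.mp (continuous_apply (A := fun _ : ℕ => Prop) n)

theorem continuous_set_nat_of_isOpen {Z : Type*} [TopologicalSpace Z] {F : Z → Set ℕ}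
    (h : ∀ n, IsOpen {z | n ∈ F z}) : Continuous F :=
  continuous_pi (A := fun _ : ℕ => Prop) fun n => continuous_Prop.mpr (h n)

/-- The map `x ↦ {n | x ∈ S n}` induces a topology at least as fine as the one generated by `S`. -/
theorem induced_setOf_mem_le_generateFrom {X : Type*} (S : ℕ → Set X) :
    TopologicalSpace.induced (fun x => {n : ℕ | x ∈ S n}) sierpinskiProductTopology ≤
      TopologicalSpace.generateFrom (Set.range S) := by
  apply le_generateFrom
  rintro _ ⟨n, rfl⟩
  exact ⟨{A : Set ℕ | n ∈ A}, isOpen_setOf_nat_mem n, rfl⟩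

theorem continuous_extension_of_countably_based {X Y : Type*}
    [tX : TopologicalSpace X] [tY : TopologicalSpace Y]
    (S : ℕ → Set X) (T : ℕ → Set Y)
    (hX : tX = TopologicalSpace.generateFrom (Set.range S))
    (hY : tY = TopologicalSpace.generateFrom (Set.range T))
    (f : X → Y) (hf : Continuous f) :
    ∃ F : Set ℕ → Set ℕ, Continuous F ∧
      ∀ x : X, F {n : ℕ | x ∈ S n} = {n : ℕ | f x ∈ T n} := by
  have hT : ∀ n, ∃ V : Set (Set ℕ), IsOpen V ∧
      (fun x => {m : ℕ | x ∈ S m}) ⁻¹' V = f ⁻¹' T n := by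
    intro n
    have hTn : IsOpen (T n) := by
      rw [hY]
      exact TopologicalSpace.isOpen_generateFrom_of_mem ⟨n, rfl⟩
    have hpre : IsOpen (f ⁻¹' T n) := hTn.preimage hf
    rw [hX] at hpre
    exact induced_setOf_mem_le_generateFrom S _ hpre
  choose V hVopen hV using hT
  refine ⟨fun A => {n | A ∈ V n}, continuous_set_nat_of_isOpen hVopen, fun x => ?_⟩
  ext n
  exact Set.ext_iff.mp (hV n) x
end
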